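/- arXiv:math-ph/0605023 — 2 statements merged into one kernel-verified Lean document; each statement's English description precedes it below -/
import Mathlib

section
/- Invariance of the fundamental invariants Δ₁₄ and Δ₁₅ of K²(E³): for all 3×3 real matrices A, B, C with A and C symmetric, all λ ∈ SO(3) and all δ ∈ ℝ³, with (Ã, B̃, C̃) the transformed parameters, each of the following quantities takes the same value on (Ã, B̃, C̃) as on (A, B, C): Δ₁₄ = 4 A_i{}^{[i} A_j{}^{j]} C_k{}^{[k} C_ℓ{}^{ℓ]} + 8 A_{ij}(A_{jk} C_{k[i} C_{ℓ]}{}^{ℓ} + A_{kk} C_{[j}{}^{ℓ} C_{ℓ]i}) + A_{ij}C_{ij}(A_{kℓ}C_{kℓ} + 4 B_k{}^{[k} B_ℓ{}^{ℓ]}) + 4 C_{ij} B_{jk} A_{kℓ} B_{iℓ} + 16 A_{ij} C_{jk} B_{[k}{}^{ℓ} B_{ℓ]i}; Δ₁₅ = A_{ij}C_{ij}[(C_{kk}C_{ℓℓ} − 3 C_{kℓ}C_{kℓ}) C_{mm} + 2 C_{kℓ}C_{ℓm}C_{mk}] − 6 A_{ij} C_{jk} C_{ki} C_ℓ{}^{[ℓ}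 C_m{}^{m]} − 12 C_{ij} B_{jk}(C_{kℓ} B_{i[ℓ} C_{m]}{}^{m} + 2 B_{kℓ} C_{i[ℓ} C_{m]}{}^{m}). -/
open Matrix

/-- 3×3 real matrices. -/
abbrev M3 := Matrix (Fin 3) (Fin 3) ℝ

/-- Membership in SO(3). -/
def SO3 (l : M3) : Prop := lᵀ * l = 1 ∧ l.det = 1

/-- The antisymmetric matrix `W_δ` with rows `(0, δ₃, −δ₂)`, `(−δ₃, 0, δ₁)`,
`(δ₂, −δ₁, 0)`. -/
def Wmat (δ : Fin 3 → ℝ) : M3 :=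
  !![0, δ 2, -δ 1; -δ 2, 0, δ 0; δ 1, -δ 0, 0]

/-- Transformed parameter `Ã = λᵀAλ + λᵀBμ + μᵀBᵀλ + μᵀCμ`, with `μ = W_δ λ`. -/
def tA (A B C l : M3) (δ : Fin 3 → ℝ) : M3 :=
  lᵀ * A * l + lᵀ * B * (Wmat δ * l) + (Wmat δ * l)ᵀ * Bᵀ * l
    + (Wmat δ * l)ᵀ * C * (Wmat δ * l)

/-- Transformed parameter `B̃ = λᵀBλ + μᵀCλ`, with `μ = W_δ λ`. -/
def tB (B C l : M3) (δ : Fin 3 → ℝ) : M3 :=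
  lᵀ * B * l + (Wmat δ * l)ᵀ * C * l

/-- Transformed parameter `C̃ = λᵀCλ`. -/
def tC (C l : M3) : M3 := lᵀ * C * l

/-- The Levi-Civita symbol on `Fin 3`. -/
noncomputable def eps (i j k : Fin 3) : ℝ :=
  (((i : ℕ) : ℝ) - ((j : ℕ) : ℝ)) * (((j : ℕ) : ℝ) - ((k : ℕ) : ℝ))
    * (((k : ℕ) : ℝ) - ((i : ℕ) : ℝ)) / 2

/-- `Δ₁₄`, where `X_i{}^{[i}X_j{}^{j]} = ½((tr X)² − tr X²)`,
`C_{k[i}C_{ℓ]}{}^{ℓ} = ½(C_{ki} tr C − C_{kℓ}C_{iℓ})`,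
`C_{[j}{}^{ℓ}C_{ℓ]i} = ½(C_{jℓ}C_{ℓi} − (tr C) C_{ji})`, and
`B_{[k}{}^{ℓ}B_{ℓ]i} = ½(B_{kℓ}B_{ℓi} − (tr B) B_{ki})`. -/
noncomputable def Delta14 (A B C : M3) : ℝ :=
  4 * (((1 : ℝ) / 2) * (A.trace ^ 2 - (A * A).trace))
      * (((1 : ℝ) / 2) * (C.trace ^ 2 - (C * C).trace))
    + 8 * (∑ i : Fin 3, ∑ j : Fin 3, A i j *
        ((∑ k : Fin 3, A j k * (((1 : ℝ) / 2) *
            (C k i * C.trace - ∑ l : Fin 3, C k l * C i l)))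
          + A.trace * (((1 : ℝ) / 2) *
              ((∑ l : Fin 3, C j l * C l i) - C.trace * C j i))))
    + (∑ i : Fin 3, ∑ j : Fin 3, A i j * C i j)
        * ((∑ k : Fin 3, ∑ l : Fin 3, A k l * C k l)
          + 4 * (((1 : ℝ) / 2) * (B.trace ^ 2 - (B * B).trace)))
    + 4 * (∑ i : Fin 3, ∑ j : Fin 3, ∑ k : Fin 3, ∑ l : Fin 3,
        C i j * B j k * A k l * B i l)
    + 16 * (∑ i : Fin 3, ∑ j : Fin 3, ∑ k : Fin 3, A i j * C j k *
        (((1 : ℝ) / 2) * ((∑ l : Fin 3, B k l * B l i) - B.trace * B k i)))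

/-- `Δ₁₅`, where `C_ℓ{}^{[ℓ}C_m{}^{m]} = ½((tr C)² − tr C²)`,
`B_{i[ℓ}C_{m]}{}^{m} = ½(B_{iℓ} tr C − B_{im}C_{ℓm})`, and
`C_{i[ℓ}C_{m]}{}^{m} = ½(C_{iℓ} tr C − C_{im}C_{ℓm})`. -/
noncomputable def Delta15 (A B C : M3) : ℝ :=
  (∑ i : Fin 3, ∑ j : Fin 3, A i j * C i j)
      * ((C.trace * C.trace - 3 * ∑ k : Fin 3, ∑ l : Fin 3, C k l * C k l)
            * C.trace
          + 2 * ∑ k : Fin 3, ∑ l : Fin 3, ∑ m : Fin 3, C k l * C l m * C m k)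
    - 6 * (∑ i : Fin 3, ∑ j : Fin 3, ∑ k : Fin 3, A i j * C j k * C k i)
        * (((1 : ℝ) / 2) * (C.trace ^ 2 - (C * C).trace))
    - 12 * (∑ i : Fin 3, ∑ j : Fin 3, ∑ k : Fin 3, C i j * B j k *
        ((∑ l : Fin 3, C k l * (((1 : ℝ) / 2) *
            (B i l * C.trace - ∑ m : Fin 3, B i m * C l m)))
          + 2 * ∑ l : Fin 3, B k l * (((1 : ℝ) / 2) *
              (C i l * C.trace - ∑ m : Fin 3, C i m * C l m))))

set_option maxRecDepth 4000 in
/-- `Δ₁₄` in terms of traces of words in the matrices and their transposes. -/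
theorem Delta14_eq_trace (A B C : M3) :
    Delta14 A B C =
      (A.trace ^ 2 - (A * A).trace) * (C.trace ^ 2 - (C * C).trace)
      + 4 * (C.trace * (A * A * C).trace - (A * A * (C * Cᵀ)).trace
        + A.trace * ((A * (C * C)).trace - C.trace * (A * C).trace))
      + (A * Cᵀ).trace * ((A * Cᵀ).trace + 2 * (B.trace ^ 2 - (B * B).trace))
      + 4 * (C * B * A * Bᵀ).trace
      + 8 * ((A * C * (B * B)).trace - B.trace * (A * C * B).trace) := by
  simp only [Delta14, Matrix.trace, Matrix.diag_apply, Matrix.mul_apply, Matrix.transpose_apply,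
    Fin.sum_univ_three]
  ring

/-- `Δ₁₅` in terms of traces of words in the matrices and their transposes. -/
theorem Delta15_eq_trace (A B C : M3) :
    Delta15 A B C =
      (A * Cᵀ).trace * ((C.trace * C.trace - 3 * (C * Cᵀ).trace) * C.trace
        + 2 * (C * C * C).trace)
      - 3 * (A * C * C).trace * (C.trace ^ 2 - (C * C).trace)
      - 6 * (C.trace * (C * B * C * Bᵀ).trace - (C * B * C * C * Bᵀ).trace
        + 2 * (C.trace * (C * B * B * Cᵀ).trace - (C * B * B * C * Cᵀ).trace)) := by
  simp only [Delta15, Matrix.trace, Matrix.diag_apply, Matrix.mul_apply, Matrix.transpose_apply,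
    Fin.sum_univ_three]
  ring

theorem conj_mul_conj {l : M3} (h : l * lᵀ = 1) (X Y : M3) :
    (lᵀ * X * l) * (lᵀ * Y * l) = lᵀ * (X * Y) * l := by
  calc (lᵀ * X * l) * (lᵀ * Y * l) = lᵀ * X * (l * lᵀ) * Y * l := by
        simp only [Matrix.mul_assoc]
    _ = lᵀ * (X * Y) * l := by rw [h, Matrix.mul_one, Matrix.mul_assoc lᵀ X Y]

theorem transpose_conj (l X : M3) : (lᵀ * X * l)ᵀ = lᵀ * Xᵀ * l := by
  simp only [Matrix.transpose_mul, Matrix.transpose_transpose, Matrix.mul_assoc]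

theorem trace_conj {l : M3} (h : l * lᵀ = 1) (X : M3) : (lᵀ * X * l).trace = X.trace := by
  rw [Matrix.trace_mul_comm, ← Matrix.mul_assoc, h, Matrix.one_mul]

theorem Delta14_conj {l : M3} (h : l * lᵀ = 1) (A B C : M3) :
    Delta14 (lᵀ * A * l) (lᵀ * B * l) (lᵀ * C * l) = Delta14 A B C := by
  simp only [Delta14_eq_trace, transpose_conj, conj_mul_conj h, trace_conj h]

theorem Delta15_conj {l : M3} (h : l * lᵀ = 1) (A B C : M3) :
    Delta15 (lᵀ * A * l) (lᵀ * B * l) (lᵀ * C * l) = Delta15 A B C := by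
  simp only [Delta15_eq_trace, transpose_conj, conj_mul_conj h, trace_conj h]

theorem tA_eq_conj (A B C l : M3) (δ : Fin 3 → ℝ) :
    tA A B C l δ = lᵀ * tA A B C 1 δ * l := by
  simp only [tA, Matrix.transpose_mul, Matrix.transpose_one, Matrix.one_mul, Matrix.mul_one,
    Matrix.mul_add, Matrix.add_mul, Matrix.mul_assoc]

theorem tB_eq_conj (B C l : M3) (δ : Fin 3 → ℝ) :
    tB B C l δ = lᵀ * tB B C 1 δ * l := by
  simp only [tB, Matrix.transpose_mul, Matrix.transpose_one, Matrix.one_mul, Matrix.mul_one,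
    Matrix.mul_add, Matrix.add_mul, Matrix.mul_assoc]

set_option maxHeartbeats 4000000 in
theorem Delta15_translate {A C : M3} (hA : A.IsSymm) (hC : C.IsSymm) (B : M3)
    (δ : Fin 3 → ℝ) : Delta15 (tA A B C 1 δ) (tB B C 1 δ) C = Delta15 A B C := by
  have a1 := hA.apply 0 1
  have a2 := hA.apply 0 2
  have a3 := hA.apply 1 2
  have c1 := hC.apply 0 1
  have c2 := hC.apply 0 2
  have c3 := hC.apply 1 2
  simp only [Delta15_eq_trace, tA, tB, Wmat, Matrix.trace, Matrix.diag_apply,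
    Matrix.mul_apply, Matrix.add_apply, Matrix.transpose_apply, Matrix.mul_one, Matrix.one_mul,
    Matrix.transpose_one, Fin.sum_univ_three, Matrix.of_apply, Matrix.cons_val, a1, a2, a3, c1, c2, c3]
  ring

set_option maxHeartbeats 4000000 in
theorem Delta14_translate {A C : M3} (hA : A.IsSymm) (hC : C.IsSymm) (B : M3)
    (δ : Fin 3 → ℝ) : Delta14 (tA A B C 1 δ) (tB B C 1 δ) C = Delta14 A B C := by
  have a1 := hA.apply 0 1
  have a2 := hA.apply 0 2
  have a3 := hA.apply 1 2
  have c1 := hC.apply 0 1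
  have c2 := hC.apply 0 2
  have c3 := hC.apply 1 2
  simp only [Delta14_eq_trace, tA, tB, Wmat, Matrix.trace, Matrix.diag_apply,
    Matrix.mul_apply, Matrix.add_apply, Matrix.transpose_apply, Matrix.mul_one, Matrix.one_mul,
    Matrix.transpose_one, Fin.sum_univ_three, Matrix.of_apply, Matrix.cons_val, a1, a2, a3, c1, c2, c3]
  ring

/-- STATEMENT 15: the fundamental invariants `Δ₁₄` and `Δ₁₅` of `K²(E³)` are
invariant under the parameter transformation rules induced by `I(E³)`. -/
theorem invariants_Delta14_and_Delta15
    (A B C : M3) (hA : A.IsSymm) (hC : C.IsSymm)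
    (l : M3) (hl : SO3 l) (δ : Fin 3 → ℝ) :
    Delta14 (tA A B C l δ) (tB B C l δ) (tC C l) = Delta14 A B C ∧
    Delta15 (tA A B C l δ) (tB B C l δ) (tC C l) = Delta15 A B C := by
  have h : l * lᵀ = 1 := mul_eq_one_comm.mp hl.1
  rw [tA_eq_conj, tB_eq_conj, tC]
  exact ⟨(Delta14_conj h _ _ _).trans (Delta14_translate hA hC B δ),
    (Delta15_conj h _ _ _).trans (Delta15_translate hA hC B δ)⟩
end

section
/- Compatibility for the Calogero–Moser potential: let Ω = {(x,y,z) ∈ ℝ³ : x ≠ y, y ≠ z, z ≠ x} and V(x,y,z) = (x−y)⁻² + (y−z)⁻² + (z−x)⁻². Let g = I₃, K₁ the symmetric matrix with zero diagonal and all off-diagonal entries 1, K₂ the matrix with rows (2y+2z, −x−y, −z−x), (−x−y, 2z+2x, −y−z), (−z−x, −y−z, 2x+2y), K₃ the matrix with rows (y²+z², −xy, −zx), (−xy, z²+x², −yz), (−zx, −yz, x²+y²), and K₄ the matrix with rows (−2yz, (x+y−z)z, (z+x−y)y), ((x+y−z)z, −2zx, (z+y−x)x), ((z+x−y)y, (z+y−x)x,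 −2xy). Then for all real a₁, α₁, b₃₂, c₃, γ₃, the tensor K = a₁ g + α₁ K₁ + b₃₂ K₂ + c₃ K₃ + γ₃ K₄ satisfies the Benenti compatibility condition d(K dV) = 0 on Ω; explicitly, the 1-form ω with components ω_i = Σ_j K^{ij} ∂_j V satisfies ∂_i ω_j = ∂_j ω_i on Ω for all i, j. Conversely, a member K_{A,B,C} of the general 20-parameter family of valence-two Killing tensors of E³ satisfies this condition on Ω only if it equals such a linear combination. -/
open Matrix

/-- The cross-product matrix `Sₓ`, satisfying `Sₓ v = x × v`. -/
def Smat (x : Fin 3 → ℝ) : M3 :=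
  !![0, -x 2, x 1; x 2, 0, -x 0; -x 1, x 0, 0]

/-- The Killing tensor field `K_{A,B,C}(x) = A + Sₓ Bᵀ + B Sₓᵀ + Sₓ C Sₓᵀ`. -/
def KABC (A B C : M3) (x : Fin 3 → ℝ) : M3 :=
  A + Smat x * Bᵀ + B * (Smat x)ᵀ + Smat x * C * (Smat x)ᵀ

/-- Partial derivative `∂_k f` at `x`. -/
noncomputable def pder (k : Fin 3) (f : (Fin 3 → ℝ) → ℝ) (x : Fin 3 → ℝ) : ℝ :=
  fderiv ℝ f x (Pi.single k 1)

/-- The open set `Ω = {(x,y,z) : x ≠ y, y ≠ z, z ≠ x}`. -/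
def Omega3 : Set (Fin 3 → ℝ) := {p | p 0 ≠ p 1 ∧ p 1 ≠ p 2 ∧ p 2 ≠ p 0}

/-- The Calogero–Moser potential `V = (x−y)⁻² + (y−z)⁻² + (z−x)⁻²`. -/
noncomputable def Vcm (p : Fin 3 → ℝ) : ℝ :=
  ((p 0 - p 1) ^ 2)⁻¹ + ((p 1 - p 2) ^ 2)⁻¹ + ((p 2 - p 0) ^ 2)⁻¹

/-- The Killing tensor `K₁`. -/
def CM1 : M3 := !![0, 1, 1; 1, 0, 1; 1, 1, 0]

/-- The Killing tensor `K₂`. -/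
def CM2 (p : Fin 3 → ℝ) : M3 :=
  !![2 * p 1 + 2 * p 2, -p 0 - p 1, -p 2 - p 0;
     -p 0 - p 1, 2 * p 2 + 2 * p 0, -p 1 - p 2;
     -p 2 - p 0, -p 1 - p 2, 2 * p 0 + 2 * p 1]

/-- The Killing tensor `K₃`. -/
def CM3 (p : Fin 3 → ℝ) : M3 :=
  !![(p 1) ^ 2 + (p 2) ^ 2, -p 0 * p 1, -p 2 * p 0;
     -p 0 * p 1, (p 2) ^ 2 + (p 0) ^ 2, -p 1 * p 2;
     -p 2 * p 0, -p 1 * p 2, (p 0) ^ 2 + (p 1) ^ 2]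

/-- The Killing tensor `K₄`. -/
def CM4 (p : Fin 3 → ℝ) : M3 :=
  !![-2 * p 1 * p 2, (p 0 + p 1 - p 2) * p 2, (p 2 + p 0 - p 1) * p 1;
     (p 0 + p 1 - p 2) * p 2, -2 * p 2 * p 0, (p 2 + p 1 - p 0) * p 0;
     (p 2 + p 0 - p 1) * p 1, (p 2 + p 1 - p 0) * p 0, -2 * p 0 * p 1]

/-- The linear combination `K = a₁ g + α₁ K₁ + b₃₂ K₂ + c₃ K₃ + γ₃ K₄`. -/
def Kcm (a₁ α₁ b₃₂ c₃ γ₃ : ℝ) (p : Fin 3 → ℝ) : M3 :=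
  a₁ • (1 : M3) + α₁ • CM1 + b₃₂ • CM2 p + c₃ • CM3 p + γ₃ • CM4 p

/-- The 1-form `ω` with components `ω_i = K^{ij} ∂_j V`. -/
noncomputable def omegaCM (K : (Fin 3 → ℝ) → M3) (i : Fin 3) (x : Fin 3 → ℝ) : ℝ :=
  ∑ j : Fin 3, K x i j * pder j Vcm x

/-- The Benenti compatibility condition `d(K dV) = 0` on `Ω`. -/
def CompatibleCM (K : (Fin 3 → ℝ) → M3) : Prop :=
  ∀ x ∈ Omega3, ∀ i j : Fin 3,
    pder i (omegaCM K j) x = pder j (omegaCM K i) x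

theorem hasFDerivAt_inv_sub_pow (n : ℕ) (a b : Fin 3) {x : Fin 3 → ℝ} (h : x a ≠ x b) :
    HasFDerivAt (fun p : Fin 3 → ℝ => ((p a - p b) ^ n)⁻¹)
      ((-n * ((x a - x b) ^ (n + 1))⁻¹) •
        (ContinuousLinearMap.proj (R := ℝ) (φ := fun _ : Fin 3 => ℝ) a -
          ContinuousLinearMap.proj (R := ℝ) (φ := fun _ : Fin 3 => ℝ) b)) x := by
  have hs : x a - x b ≠ 0 := sub_ne_zero.mpr h
  have h1 : HasFDerivAt (fun p : Fin 3 → ℝ => p a - p b)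
      (ContinuousLinearMap.proj (R := ℝ) (φ := fun _ : Fin 3 => ℝ) a -
        ContinuousLinearMap.proj (R := ℝ) (φ := fun _ : Fin 3 => ℝ) b) x :=
    (hasFDerivAt_apply a x).sub (hasFDerivAt_apply b x)
  have h2 : HasDerivAt (fun t : ℝ => (t ^ n)⁻¹) (-n * ((x a - x b) ^ (n + 1))⁻¹) (x a - x b) := by
    refine ((hasDerivAt_pow n (x a - x b)).inv (pow_ne_zero n hs)).congr_deriv ?_
    rcases n with _ | n
    · simp
    · simp only [Nat.add_sub_cancel]
      field_simp
      ring
  exact HasDerivAt.comp_hasFDerivAt (h₂ := fun t : ℝ => (t ^ n)⁻¹) x h2 h1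

/-- The difference of the `a`-th and `b`-th components of the `k`-th standard basis vector. -/
def basisDiff (k a b : Fin 3) : ℝ :=
  (Pi.single k 1 : Fin 3 → ℝ) a - (Pi.single k 1 : Fin 3 → ℝ) b

/-- The partial derivatives of the Calogero–Moser potential. -/
noncomputable def gradVcm (l : Fin 3) (p : Fin 3 → ℝ) : ℝ :=
  -2 * (((p 0 - p 1) ^ 3)⁻¹ * basisDiff l 0 1 + ((p 1 - p 2) ^ 3)⁻¹ * basisDiff l 1 2 +
    ((p 2 - p 0) ^ 3)⁻¹ * basisDiff l 2 0)

/-- The second partial derivatives of the Calogero–Moser potential. -/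
noncomputable def hessVcm (k l : Fin 3) (p : Fin 3 → ℝ) : ℝ :=
  6 * (((p 0 - p 1) ^ 4)⁻¹ * basisDiff k 0 1 * basisDiff l 0 1 +
    ((p 1 - p 2) ^ 4)⁻¹ * basisDiff k 1 2 * basisDiff l 1 2 +
    ((p 2 - p 0) ^ 4)⁻¹ * basisDiff k 2 0 * basisDiff l 2 0)

theorem isOpen_Omega3 : IsOpen Omega3 := by
  unfold Omega3
  refine IsOpen.inter ?_ (IsOpen.inter ?_ ?_) <;>
    exact isOpen_ne_fun (by fun_prop) (by fun_prop)

theorem pder_Vcm {x : Fin 3 → ℝ} (hx : x ∈ Omega3) (l : Fin 3) :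
    pder l Vcm x = gradVcm l x := by
  obtain ⟨h₁, h₂, h₃⟩ := hx
  have h := ((hasFDerivAt_inv_sub_pow 2 0 1 h₁).add (hasFDerivAt_inv_sub_pow 2 1 2 h₂)).add
    (hasFDerivAt_inv_sub_pow 2 2 0 h₃)
  have h' : HasFDerivAt Vcm _ x := h
  rw [pder, h'.fderiv]
  simp [gradVcm, basisDiff]
  ring

theorem differentiableAt_gradVcm {x : Fin 3 → ℝ} (hx : x ∈ Omega3) (l : Fin 3) :
    DifferentiableAt ℝ (gradVcm l) x := by
  obtain ⟨h₁, h₂, h₃⟩ := hx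
  exact (((((hasFDerivAt_inv_sub_pow 3 0 1 h₁).differentiableAt.mul_const _).add
    ((hasFDerivAt_inv_sub_pow 3 1 2 h₂).differentiableAt.mul_const _)).add
    ((hasFDerivAt_inv_sub_pow 3 2 0 h₃).differentiableAt.mul_const _)).const_mul _)

theorem pder_gradVcm {x : Fin 3 → ℝ} (hx : x ∈ Omega3) (k l : Fin 3) :
    pder k (gradVcm l) x = hessVcm k l x := by
  obtain ⟨h₁, h₂, h₃⟩ := hx
  have h := ((((hasFDerivAt_inv_sub_pow 3 0 1 h₁).mul_const (basisDiff l 0 1)).add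
    ((hasFDerivAt_inv_sub_pow 3 1 2 h₂).mul_const (basisDiff l 1 2))).add
    ((hasFDerivAt_inv_sub_pow 3 2 0 h₃).mul_const (basisDiff l 2 0))).const_mul (-2)
  have h' : HasFDerivAt (gradVcm l) _ x := h
  rw [pder, h'.fderiv]
  simp [hessVcm, basisDiff]
  ring

theorem pder_omegaCM {K : (Fin 3 → ℝ) → M3} {x : Fin 3 → ℝ} (hx : x ∈ Omega3) (k i : Fin 3)
    (hK : ∀ j, DifferentiableAt ℝ (fun p => K p i j) x) :
    pder k (omegaCM K i) x =
      ∑ j, (pder k (fun p => K p i j) x * gradVcm j x + K x i j * hessVcm k j x) := by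
  have hev : omegaCM K i =ᶠ[nhds x] fun p => ∑ j, K p i j * gradVcm j p := by
    filter_upwards [isOpen_Omega3.mem_nhds hx] with p hp
    exact Finset.sum_congr rfl fun j _ => by rw [pder_Vcm hp]
  have hsum := HasFDerivAt.fun_sum (u := Finset.univ) fun j _ =>
    (hK j).hasFDerivAt.fun_mul (differentiableAt_gradVcm hx j).hasFDerivAt
  rw [pder, hev.fderiv_eq, hsum.fderiv, _root_.sum_apply]
  refine Finset.sum_congr rfl fun j _ => ?_
  rw [← pder_gradVcm hx, pder, pder]
  simp
  ring

theorem differentiable_KABC_apply (A B C : M3) (i j : Fin 3) :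
    Differentiable ℝ (fun p => KABC A B C p i j) := by
  fin_cases i <;> fin_cases j <;>
    simp [KABC, Smat, Matrix.mul_apply, Fin.sum_univ_three, Matrix.vecMul, dotProduct] <;> fun_prop

/-- The derivative of the tensor field `K_{A,B,C}` at `x` in the direction `v`. -/
def derivKABC (B C : M3) (v x : Fin 3 → ℝ) : M3 :=
  Smat v * Bᵀ + B * (Smat v)ᵀ + (Smat v * C * (Smat x)ᵀ + Smat x * C * (Smat v)ᵀ)

theorem Smat_add_smul (x v : Fin 3 → ℝ) (t : ℝ) : Smat (x + t • v) = Smat x + t • Smat v := by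
  ext i j
  fin_cases i <;> fin_cases j <;> simp [Smat] <;> ring

theorem KABC_add_smul (A B C : M3) (x v : Fin 3 → ℝ) (t : ℝ) :
    KABC A B C (x + t • v) =
      KABC A B C x + t • derivKABC B C v x + t ^ 2 • (Smat v * C * (Smat v)ᵀ) := by
  simp only [KABC, derivKABC, Smat_add_smul, Matrix.transpose_add, Matrix.transpose_smul,
    Matrix.add_mul, Matrix.mul_add, Matrix.smul_mul, Matrix.mul_smul, smul_add, smul_smul, sq]
  abel

theorem pder_KABC_apply (A B C : M3) (k i j : Fin 3) (x : Fin 3 → ℝ) :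
    pder k (fun p => KABC A B C p i j) x = derivKABC B C (Pi.single k 1) x i j := by
  rw [pder, ← (differentiable_KABC_apply A B C i j x).lineDeriv_eq_fderiv, lineDeriv]
  simp only [KABC_add_smul, Matrix.add_apply, Matrix.smul_apply, smul_eq_mul]
  have h := (((hasDerivAt_id (0 : ℝ)).mul_const (derivKABC B C (Pi.single k 1) x i j)).const_add
    (KABC A B C x i j)).add ((hasDerivAt_pow 2 (0 : ℝ)).mul_const
      ((Smat (Pi.single k 1) * C * (Smat (Pi.single k 1))ᵀ) i j))
  exact h.deriv.trans (by simp)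

theorem compatibleCM_KABC_iff (A B C : M3) :
    CompatibleCM (KABC A B C) ↔ ∀ x ∈ Omega3, ∀ i j : Fin 3,
      ∑ l, (derivKABC B C (Pi.single i 1) x j l * gradVcm l x +
          KABC A B C x j l * hessVcm i l x) =
        ∑ l, (derivKABC B C (Pi.single j 1) x i l * gradVcm l x +
          KABC A B C x i l * hessVcm j l x) := by
  refine forall₂_congr fun x hx => forall₂_congr fun i j => ?_
  rw [pder_omegaCM hx i j fun l => differentiable_KABC_apply A B C j l x,
    pder_omegaCM hx j i fun l => differentiable_KABC_apply A B C i l x]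
  simp only [pder_KABC_apply]

theorem Kcm_eq_KABC (a₁ α₁ b₃₂ c₃ γ₃ : ℝ) :
    Kcm a₁ α₁ b₃₂ c₃ γ₃ =
      KABC !![a₁, α₁, α₁; α₁, a₁, α₁; α₁, α₁, a₁]
        !![0, -b₃₂, b₃₂; b₃₂, 0, -b₃₂; -b₃₂, b₃₂, 0]
        !![c₃, γ₃, γ₃; γ₃, c₃, γ₃; γ₃, γ₃, c₃] := by
  funext p
  ext i j
  simp only [KABC, Matrix.add_apply, Matrix.mul_apply, Fin.sum_univ_three, Matrix.transpose_apply]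
  fin_cases i <;> fin_cases j <;> simp [Kcm, CM1, CM2, CM3, CM4, Smat] <;> ring

theorem compatibleCM_Kcm (a₁ α₁ b₃₂ c₃ γ₃ : ℝ) : CompatibleCM (Kcm a₁ α₁ b₃₂ c₃ γ₃) := by
  rw [Kcm_eq_KABC, compatibleCM_KABC_iff]
  rintro x ⟨h₁, h₂, h₃⟩ i j
  have h₁' := sub_ne_zero.mpr h₁
  have h₂' := sub_ne_zero.mpr h₂
  have h₃' := sub_ne_zero.mpr h₃
  simp only [KABC, derivKABC, Matrix.add_apply, Matrix.mul_apply, Fin.sum_univ_three,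
    Matrix.transpose_apply]
  fin_cases i <;> fin_cases j <;> try rfl
  all_goals
    simp [gradVcm, hessVcm, basisDiff, Smat]
    field_simp
    ring

set_option maxHeartbeats 1000000 in
theorem eq_Kcm_of_compatibleCM {A B C : M3} (hA : A.IsSymm) (hC : C.IsSymm)
    (h : CompatibleCM (KABC A B C)) :
    KABC A B C = Kcm (A 2 2) (A 1 2) (B 2 1) (C 2 2) (C 1 2) := by
  rw [compatibleCM_KABC_iff] at h
  have hA₁ := hA.apply 0 1
  have hA₂ := hA.apply 0 2
  have hA₃ := hA.apply 1 2
  have hC₁ := hC.apply 0 1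
  have hC₂ := hC.apply 0 2
  have hC₃ := hC.apply 1 2
  simp only [KABC, derivKABC, Matrix.add_apply, Matrix.mul_apply, Fin.sum_univ_three,
    Matrix.transpose_apply] at h
  have h01 (a b c : ℝ) (habc : a ≠ b ∧ b ≠ c ∧ c ≠ a) := h ![a, b, c] habc 0 1
  have h12 (a b c : ℝ) (habc : a ≠ b ∧ b ≠ c ∧ c ≠ a) := h ![a, b, c] habc 1 2
  have h20 (a b c : ℝ) (habc : a ≠ b ∧ b ≠ c ∧ c ≠ a) := h ![a, b, c] habc 2 0
  simp [gradVcm, hessVcm, basisDiff, Smat, hA₁, hA₂, hA₃, hC₁, hC₂, hC₃] at h01 h12 h20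
  have e1 := h01 (-1) 0 1 (by norm_num) (by norm_num) (by norm_num)
  have e2 := h12 (-1) 0 1 (by norm_num) (by norm_num) (by norm_num)
  have e3 := h20 (-1) 0 1 (by norm_num) (by norm_num) (by norm_num)
  have e4 := h01 (-1) 1 0 (by norm_num) (by norm_num) (by norm_num)
  have e5 := h12 (-1) 1 0 (by norm_num) (by norm_num) (by norm_num)
  have e6 := h20 (-1) 1 0 (by norm_num) (by norm_num) (by norm_num)
  have e7 := h01 0 (-1) 1 (by norm_num) (by norm_num) (by norm_num)
  have e8 := h12 0 (-1) 1 (by norm_num) (by norm_num) (by norm_num)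
  have e9 := h01 0 1 (-1) (by norm_num) (by norm_num) (by norm_num)
  have e10 := h12 0 1 (-1) (by norm_num) (by norm_num) (by norm_num)
  have e11 := h12 1 (-1) 0 (by norm_num) (by norm_num) (by norm_num)
  have e12 := h01 (-2) (-1) 0 (by norm_num) (by norm_num) (by norm_num)
  have e13 := h12 (-2) (-1) 0 (by norm_num) (by norm_num) (by norm_num)
  have e14 := h20 (-2) (-1) 0 (by norm_num) (by norm_num) (by norm_num)
  have e15 := h01 (-2) 0 (-1) (by norm_num) (by norm_num) (by norm_num)
  clear h01 h12 h20 h hA hC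
  ring_nf at e1 e2 e3 e4 e5 e6 e7 e8 e9 e10 e11 e12 e13 e14 e15
  have a1 : A 0 0 = A 2 2 := by
    linear_combination
      64/405 * e1 + 64/405 * e2 - 92/405 * e3 - 4/45 * e4 - 4/45 * e8
  have a2 : A 0 1 = A 1 2 := by
    linear_combination
      -4/405 * e1 - 4/405 * e2 - 28/405 * e3 + 4/45 * e4 + 4/45 * e8
  have a3 : A 0 2 = A 1 2 := by
    linear_combination
      -4/45 * e3 + 28/405 * e4 + 4/405 * e5 + 4/405 * e6 - 4/45 * e10
  have a4 : A 1 1 = A 2 2 := by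
    linear_combination
      64/405 * e1 + 64/405 * e2 - 128/405 * e3 - 128/405 * e4 + 64/405 * e5 + 64/405 * e6
        - 4/45 * e8 - 4/45 * e10
  have b1 : B 0 0 = B 2 2 := by
    linear_combination
      1/243 * e1 - 2/243 * e2 - 469/4860 * e3 - 569/4860 * e4 + 167/2430 * e5 + 5/243 * e6
        + 1/90 * e7 - 7/180 * e8 - 19/810 * e9 - 1/81 * e10 - 29/810 * e11 + 5/162 * e12 -
        1/162 * e13 + 1/81 * e14
  have b2 : B 0 1 = -B 2 1 := by
    linear_combination
      -8/243 * e1 + 64/3645 * e2 - 43/2916 * e3 - 235/2916 * e4 + 76/3645 * e5 + 184/3645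
        * e6 + 4/135 * e7 - 11/540 * e8 + 76/3645 * e9 - 439/7290 * e10 - 76/3645 * e11 +
        8/243 * e12 + 8/243 * e13 - 16/243 * e14
  have b3 : B 0 2 = B 2 1 := by
    linear_combination
      11/486 * e1 - 37/1215 * e2 + 38/1215 * e3 + 221/2430 * e4 - 239/4860 * e5 - 169/2430
        * e6 - 1/20 * e7 + 1/45 * e8 - 1/324 * e9 + 29/810 * e10 + 53/1620 * e11 - 13/324
        * e12 - 7/324 * e13 + 7/162 * e14
  have b4 : B 1 0 = B 2 1 := by
    linear_combination
      13/486 * e1 + 5/243 * e2 - 191/4860 * e3 - 1/4860 * e4 - 49/4860 * e5 + 5/486 * e6 -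
        7/180 * e7 + 1/90 * e8 + 53/1620 * e9 + 7/324 * e10 + 43/1620 * e11 - 1/108 * e12
        - 1/36 * e13 + 1/18 * e14
  have b5 : B 1 1 = B 2 2 := by
    linear_combination
      -11/486 * e1 - 107/1215 * e2 + 433/4860 * e3 + 143/4860 * e4 + 19/972 * e5 -
        119/2430 * e6 - 7/180 * e7 + 1/90 * e8 - 43/1620 * e9 + 83/1620 * e10 - 1/324 *
        e11 + 13/324 * e12 + 7/324 * e13 - 7/162 * e14
  have b6 : B 1 2 = -B 2 1 := by
    linear_combination
      -5/486 * e1 + 169/3645 * e2 - 677/14580 * e3 - 767/14580 * e4 + 451/14580 * e5 +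
        293/7290 * e6 + 37/540 * e7 - 8/135 * e8 - 173/14580 * e9 - 383/14580 * e10 -
        691/14580 * e11 - 7/972 * e12 + 11/972 * e13 - 11/486 * e14
  have b7 : B 2 0 = -B 2 1 := by
    linear_combination
      -1/162 * e1 - 77/3645 * e2 + 49/14580 * e3 - 341/14580 * e4 + 589/14580 * e5 +
        11/7290 * e6 - 1/108 * e7 + 5/108 * e8 - 83/14580 * e9 - 134/3645 * e10 -
        349/14580 * e11 + 23/972 * e12 + 5/972 * e13 - 5/486 * e14
  have c1 : C 0 0 = C 2 2 := by
    linear_combination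
      -13/2430 * e1 + 179/2430 * e2 - 43/2430 * e3 + 277/2430 * e4 - 197/2430 * e5 - 8/243
        * e6 + 1/90 * e7 - 1/90 * e8 - 23/810 * e9 + 8/405 * e10 - 7/810 * e11 - 8/405 *
        e12 - 8/405 * e13 - 8/405 * e14
  have c2 : C 0 1 = C 1 2 := by
    linear_combination
      251/4860 * e1 - 133/4860 * e2 - 499/4860 * e3 - 419/4860 * e4 + 259/4860 * e5 +
        8/243 * e6 - 7/180 * e7 + 7/180 * e8 + 1/1620 * e9 - 8/405 * e10 - 31/1620 * e11 +
        8/405 * e12 + 8/405 * e13 + 8/405 * e14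
  have c3 : C 0 2 = C 1 2 := by
    linear_combination
      -191/2430 * e1 - 61/486 * e2 + 959/4860 * e3 + 215/972 * e4 - 32/1215 * e5 -
        659/4860 * e6 - 4/135 * e7 + 4/135 * e8 - 22/405 * e9 + 113/1620 * e10 + 5/324 *
        e11 + 23/810 * e12 + 1/162 * e13 - 1/81 * e14 - 8/135 * e15
  have c4 : C 1 1 = C 2 2 := by
    linear_combination
      -23/810 * e1 + 1/270 * e2 + 11/270 * e3 + 13/270 * e4 + 1/45 * e5 - 1/90 * e6 + 1/27
        * e7 - 1/27 * e8 - 11/405 * e9 + 1/162 * e10 - 17/810 * e11 + 7/810 * e12 - 11/810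
        * e13 - 13/405 * e14 - 8/135 * e15
  rw [Kcm_eq_KABC]
  funext p
  ext i j
  simp only [KABC, Matrix.add_apply, Matrix.mul_apply, Fin.sum_univ_three, Matrix.transpose_apply]
  fin_cases i <;> fin_cases j <;>
    simp [Smat, hA₁, hA₂, hA₃, hC₁, hC₂, hC₃, a1, a2, a3, a4, b1, b2, b3, b4, b5, b6, b7,
      c1, c2, c3, c4] <;> ring

/-- STATEMENT 18: every linear combination `a₁ g + α₁ K₁ + b₃₂ K₂ + c₃ K₃ + γ₃ K₄`
satisfies the Benenti compatibility condition with the Calogero–Moser potential on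
`Ω`; conversely a Killing tensor `K_{A,B,C}` satisfies it only if it equals such a
linear combination. -/
theorem calogero_moser_compatibility :
    (∀ a₁ α₁ b₃₂ c₃ γ₃ : ℝ, CompatibleCM (Kcm a₁ α₁ b₃₂ c₃ γ₃)) ∧
    (∀ A B C : M3, A.IsSymm → C.IsSymm → CompatibleCM (KABC A B C) →
      ∃ a₁ α₁ b₃₂ c₃ γ₃ : ℝ, KABC A B C = Kcm a₁ α₁ b₃₂ c₃ γ₃) :=
  ⟨compatibleCM_Kcm, fun _ _ _ hA hC h => ⟨_, _, _, _, _, eq_Kcm_of_compatibleCM hA hC h⟩⟩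
end
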